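/- Let 0<q<1, v > -1, and let t be a real number with v + t > -1. Then for every x ∈ ℝ_q^+, (1-q) c_{q,v} Σ_{n∈ℤ} q^{(1+v+t)n} j_v(q^n x, q²) = ((q^{1+v-t};q²)_∞ / (q^{1+v+t};q²)_∞) · x^{-(1+v+t)}, the bilateral series converging absolutely. -/

import Mathlib

open scoped BigOperators

noncomputable section

/-- Finite q-Pochhammer symbol `(a;q)_n = ∏_{i=0}^{n-1} (1 - a q^i)`. -/
def qPoch (a q : ℝ) (n : ℕ) : ℝ := ∏ i ∈ Finset.range n, (1 - a * q ^ i)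

/-- Infinite q-Pochhammer symbol `(a;q)_∞ = ∏_{i=0}^{∞} (1 - a q^i)`. -/
def qPochInf (a q : ℝ) : ℝ := ∏' i : ℕ, (1 - a * q ^ i)

/-- Normalized Hahn–Exton q-Bessel function `j_v(x,q²)`. -/
def jHE (q v x : ℝ) : ℝ :=
  ∑' n : ℕ, (-1 : ℝ) ^ n * q ^ (n * (n + 1)) * x ^ (2 * n) /
    (qPoch (q ^ 2) (q ^ 2) n * qPoch (q ^ (2 * v + 2)) (q ^ 2) n)

/-- Hahn–Exton q-Bessel function with base `p`:
`J_v(x,p) = (x^v/(p;p)_∞) Σ_{n} (-1)^n p^{n(n+1)/2} (p^{v+n+1};p)_∞ x^{2n}/(p;p)_n`.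
With `p = q²` this is `J_v(x,q²)`. -/
def JHE (p v x : ℝ) : ℝ :=
  (x ^ v / qPochInf p p) *
    ∑' n : ℕ, (-1 : ℝ) ^ n * p ^ (((n : ℝ) * ((n : ℝ) + 1)) / 2) *
      qPochInf (p ^ (v + (n : ℝ) + 1)) p * x ^ (2 * n) / qPoch p p n

/-- The constant `c_{q,v}`. -/
def cqv (q v : ℝ) : ℝ :=
  (1 / (1 - q)) * qPochInf (q ^ (2 * v + 2)) (q ^ 2) / qPochInf (q ^ 2) (q ^ 2)

/-- Jackson q-integral on `[0,∞)`: `∫_0^∞ f(x) d_q x = (1-q) Σ_{n∈ℤ} q^n f(q^n)`. -/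
def jackson (q : ℝ) (f : ℝ → ℝ) : ℝ := (1 - q) * ∑' n : ℤ, q ^ n * f (q ^ n)

/-- The q-lattice `ℝ_q^+ = {q^n : n ∈ ℤ}`. -/
def Rq (q : ℝ) : Set ℝ := {x | ∃ n : ℤ, x = q ^ n}

/-- Membership in `L_{q,1,v}`: the Jackson integral `∫_0^∞ |f(x)| x^{2v+1} d_q x`
converges (absolutely). -/
def memL1 (q v : ℝ) (f : ℝ → ℝ) : Prop :=
  Summable fun n : ℤ => q ^ n * |f (q ^ n)| * (q ^ n) ^ (2 * v + 1 : ℝ)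

/-- q-Bessel Fourier transform `F_{q,v}`. -/
def qFourier (q v : ℝ) (f : ℝ → ℝ) (x : ℝ) : ℝ :=
  cqv q v * jackson q fun t => f t * jHE q v (x * t) * t ^ (2 * v + 1 : ℝ)

/-- q-translation operator `T_{q,x}^v`. -/
def qTrans (q v x : ℝ) (f : ℝ → ℝ) (y : ℝ) : ℝ :=
  cqv q v * jackson q fun t =>
    qFourier q v f t * jHE q v (x * t) * jHE q v (y * t) * t ^ (2 * v + 1 : ℝ)

/-- The kernel `D_v(x,y,z)`. -/
def Dker (q v x y z : ℝ) : ℝ :=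
  (cqv q v) ^ 2 * jackson q fun t =>
    jHE q v (x * t) * jHE q v (y * t) * jHE q v (z * t) * t ^ (2 * v + 1 : ℝ)

/-- Positivity of the q-translation operator `T_{q,x}^v`. -/
def IsPosT (q v x : ℝ) : Prop :=
  ∀ f : ℝ → ℝ, memL1 q v f → (∀ y ∈ Rq q, 0 ≤ f y) → ∀ y ∈ Rq q, 0 ≤ qTrans q v x f y

/-- The positivity domain `Q_v`. -/
def Qset (v : ℝ) : Set ℝ :=
  {q | q ∈ Set.Ioo (0 : ℝ) 1 ∧ ∀ x ∈ Rq q, IsPosT q v x}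

/-- The kernel `E_{v,x}(q^m,q^z,q^k)`. -/
def Ekern (q v x : ℝ) (m z k : ℤ) : ℝ :=
  (1 / ((1 - q) ^ 2 * cqv q v * cqv q (x - v))) *
    q ^ (-(k : ℝ) * (x + 2) - (m : ℝ) * v - (z : ℝ) * (x - v)) *
    JHE (q ^ 2) ((z : ℝ) - (k : ℝ)) (q ^ (x - v + (m : ℝ) - (k : ℝ))) *
    JHE (q ^ 2) (v + (z : ℝ) - (k : ℝ)) (q ^ ((m : ℝ) - (k : ℝ)))

/-- The function `q ↦ ₁φ₁(0;q;q,q) = Σ_{n} (-1)^n q^{n(n+1)/2} q^n /((q;q)_n)²`. -/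
def phiQ (q : ℝ) : ℝ :=
  ∑' n : ℕ, (-1 : ℝ) ^ n * q ^ (((n : ℝ) * ((n : ℝ) + 1)) / 2) * q ^ n / (qPoch q q n) ^ 2

/-- Coefficients of Euler's expansion of `(a;p)_∞` in powers of `a`. -/
def eulerCoeff (p : ℝ) (k : ℕ) : ℝ := (-1) ^ k * p ^ (k.choose 2) / qPoch p p k

lemma qPoch_succ (a p : ℝ) (n : ℕ) : qPoch a p (n + 1) = qPoch a p n * (1 - a * p ^ n) :=
  Finset.prod_range_succ _ _

lemma qPoch_pos {a p : ℝ} (ha1 : a < 1) (ha0 : 0 ≤ a) (hp0 : 0 < p) (hp1 : p < 1) (n : ℕ) :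
    0 < qPoch a p n := by
  refine Finset.prod_pos fun i _ => ?_
  have h := mul_le_of_le_one_right ha0 (pow_le_one₀ hp0.le hp1.le : p ^ i ≤ 1)
  linarith

lemma multipliable_one_sub_mul_pow (a : ℝ) {p : ℝ} (hp0 : 0 < p) (hp1 : p < 1) :
    Multipliable fun i : ℕ => 1 - a * p ^ i := by
  have h : Summable fun i : ℕ => ‖-(a * p ^ i)‖ := by
    simp only [norm_neg, norm_mul, norm_pow, Real.norm_of_nonneg hp0.le]
    exact (summable_geometric_of_lt_one hp0.le hp1).mul_left _
  simpa [sub_eq_add_neg] using multipliable_one_add_of_summable h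

lemma tendsto_qPoch (a : ℝ) {p : ℝ} (hp0 : 0 < p) (hp1 : p < 1) :
    Filter.Tendsto (qPoch a p) Filter.atTop (nhds (qPochInf a p)) :=
  (multipliable_one_sub_mul_pow a hp0 hp1).hasProd.tendsto_prod_nat

lemma qPoch_add (a p : ℝ) (j n : ℕ) :
    qPoch a p (j + n) = qPoch a p j * qPoch (a * p ^ j) p n := by
  simp only [qPoch, Finset.prod_range_add, pow_add, mul_assoc]

lemma qPoch_mul_qPochInf (a : ℝ) {p : ℝ} (hp0 : 0 < p) (hp1 : p < 1) (j : ℕ) :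
    qPoch a p j * qPochInf (a * p ^ j) p = qPochInf a p := by
  have h1 := (tendsto_qPoch (a * p ^ j) hp0 hp1).const_mul (qPoch a p j)
  have h2 := (tendsto_qPoch a hp0 hp1).comp (Filter.tendsto_add_atTop_nat j)
  refine tendsto_nhds_unique h1 (h2.congr fun n => ?_)
  simp [add_comm n j, qPoch_add]

lemma tendsto_tsum_mul_pow {c : ℕ → ℝ} {a p : ℝ} (hp0 : 0 < p) (hp1 : p < 1)
    (hs : Summable fun k => ‖c k * a ^ k‖) :
    Filter.Tendsto (fun N : ℕ => ∑' k, c k * (a * p ^ N) ^ k) Filter.atTop (nhds (c 0)) := by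
  have h0 : c 0 = ∑' k, if k = 0 then c 0 else 0 := by rw [tsum_ite_eq]
  rw [h0]
  refine tendsto_tsum_of_dominated_convergence hs (fun k => ?_) (Filter.Eventually.of_forall ?_)
  · rcases eq_or_ne k 0 with rfl | hk
    · simp
    · have h1 := (tendsto_pow_atTop_nhds_zero_of_lt_one hp0.le hp1).const_mul a
      simpa [hk] using (h1.pow k).const_mul (c k)
  · intro N k
    rw [mul_pow, ← mul_assoc, norm_mul]
    refine mul_le_of_le_one_right (norm_nonneg _) ?_
    rw [Real.norm_of_nonneg (by positivity)]
    exact pow_le_one₀ (by positivity) (pow_le_one₀ hp0.le hp1.le)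

lemma tendsto_one_sub_mul_pow {p : ℝ} (hp0 : 0 < p) (hp1 : p < 1) :
    Filter.Tendsto (fun k : ℕ => 1 - p * p ^ k) Filter.atTop (nhds 1) := by
  simpa using ((tendsto_pow_atTop_nhds_zero_of_lt_one hp0.le hp1).const_mul p).const_sub 1

lemma eulerCoeff_succ {p : ℝ} (hp0 : 0 < p) (hp1 : p < 1) (k : ℕ) :
    eulerCoeff p (k + 1) * (1 - p * p ^ k) = -(p ^ k * eulerCoeff p k) := by
  have h1 := (qPoch_pos hp1 hp0.le hp0 hp1 k).ne'
  have h2 := (qPoch_pos hp1 hp0.le hp0 hp1 (k + 1)).ne'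
  rw [qPoch_succ] at h2
  have h3 := right_ne_zero_of_mul h2
  rw [eulerCoeff, eulerCoeff, qPoch_succ, Nat.choose_succ_succ' k 1, Nat.choose_one_right]
  field_simp
  ring

lemma eulerCoeff_ne_zero {p : ℝ} (hp0 : 0 < p) (hp1 : p < 1) (k : ℕ) : eulerCoeff p k ≠ 0 := by
  have h1 := (qPoch_pos hp1 hp0.le hp0 hp1 k).ne'
  unfold eulerCoeff
  positivity

lemma summable_eulerCoeff {p a : ℝ} (hp0 : 0 < p) (hp1 : p < 1) (ha : 0 < a) :
    Summable fun k => ‖eulerCoeff p k * a ^ k‖ := by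
  refine (summable_of_ratio_test_tendsto_lt_one (l := 0) one_pos
    (Filter.Eventually.of_forall fun k =>
      mul_ne_zero (eulerCoeff_ne_zero hp0 hp1 k) (by positivity)) ?_).norm
  have h := ((tendsto_pow_atTop_nhds_zero_of_lt_one hp0.le hp1).mul_const a).div
    (tendsto_one_sub_mul_pow hp0 hp1) one_ne_zero
  rw [zero_mul, zero_div] at h
  refine h.congr fun k => ?_
  have h3 : 0 < 1 - p * p ^ k := by
    have := mul_lt_one_of_nonneg_of_lt_one_left hp0.le hp1 (pow_le_one₀ hp0.le hp1.le : p ^ k ≤ 1)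
    linarith
  have h4 := eulerCoeff_succ hp0 hp1 k
  have h5 : eulerCoeff p (k + 1) * a ^ (k + 1)
      = -(p ^ k * a / (1 - p * p ^ k)) * (eulerCoeff p k * a ^ k) := by
    rw [eq_div_of_mul_eq h3.ne' h4, pow_succ]
    ring
  have h6 : ‖eulerCoeff p k * a ^ k‖ ≠ 0 :=
    norm_ne_zero_iff.2 (mul_ne_zero (eulerCoeff_ne_zero hp0 hp1 k) (by positivity))
  rw [h5, norm_mul, mul_div_cancel_right₀ _ h6, norm_neg, Real.norm_of_nonneg (by positivity)]
  rfl

/-- Euler's expansion of `(a;p)_∞`. -/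
lemma tsum_eulerCoeff {p a : ℝ} (hp0 : 0 < p) (hp1 : p < 1) (ha : 0 < a) :
    ∑' k, eulerCoeff p k * a ^ k = qPochInf a p := by
  have step : ∀ b : ℝ, 0 < b → ∑' k, eulerCoeff p k * b ^ k
      = (1 - b) * ∑' k, eulerCoeff p k * (b * p) ^ k := by
    intro b hb
    have s1 := (summable_eulerCoeff hp0 hp1 hb).of_norm
    have s2 := (summable_eulerCoeff hp0 hp1 (mul_pos hb hp0)).of_norm
    have s1' := (summable_nat_add_iff 1).2 s1
    have s2' := (summable_nat_add_iff 1).2 s2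
    have key : ∑' k, eulerCoeff p (k + 1) * b ^ (k + 1)
        = ∑' k, eulerCoeff p (k + 1) * (b * p) ^ (k + 1)
          - b * ∑' k, eulerCoeff p k * (b * p) ^ k := by
      rw [← tsum_mul_left, ← s2'.tsum_sub (s2.mul_left b)]
      refine tsum_congr fun k => ?_
      have := eulerCoeff_succ hp0 hp1 k
      rw [mul_pow, mul_pow, pow_succ, pow_succ p]
      linear_combination (b ^ k * b) * this
    rw [s1.tsum_eq_zero_add, key, one_sub_mul]
    conv_rhs => arg 1; rw [s2.tsum_eq_zero_add]
    simp only [pow_zero]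
    ring
  have iter : ∀ N : ℕ, ∑' k, eulerCoeff p k * a ^ k
      = qPoch a p N * ∑' k, eulerCoeff p k * (a * p ^ N) ^ k := by
    intro N
    induction N with
    | zero => simp [qPoch]
    | succ N ih =>
      rw [ih, step _ (by positivity), qPoch_succ, pow_succ, ← mul_assoc, ← mul_assoc a]
  have h := (tendsto_qPoch a hp0 hp1).mul
    (tendsto_tsum_mul_pow hp0 hp1 (summable_eulerCoeff hp0 hp1 ha))
  have h' := tendsto_nhds_unique (h.congr fun N => (iter N).symm) tendsto_const_nhds
  rw [← h']
  simp [eulerCoeff, qPoch]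

lemma summable_pow_div_qPoch {p z : ℝ} (hp0 : 0 < p) (hp1 : p < 1) (hz0 : 0 < z) (hz1 : z < 1) :
    Summable fun k => ‖(qPoch p p k)⁻¹ * z ^ k‖ := by
  have hne : ∀ k, (qPoch p p k)⁻¹ * z ^ k ≠ 0 := fun k =>
    (mul_pos (inv_pos.2 (qPoch_pos hp1 hp0.le hp0 hp1 k)) (by positivity)).ne'
  refine (summable_of_ratio_test_tendsto_lt_one hz1 (Filter.Eventually.of_forall hne) ?_).norm
  have h := (tendsto_const_nhds (x := z)).div (tendsto_one_sub_mul_pow hp0 hp1) one_ne_zero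
  rw [div_one] at h
  refine h.congr fun k => ?_
  have h1 := qPoch_pos hp1 hp0.le hp0 hp1 k
  have h2 := qPoch_pos hp1 hp0.le hp0 hp1 (k + 1)
  rw [← norm_div, qPoch_succ]
  rw [qPoch_succ] at h2
  have h3 := pos_of_mul_pos_right h2 h1.le
  have : (qPoch p p k * (1 - p * p ^ k))⁻¹ * z ^ (k + 1) / ((qPoch p p k)⁻¹ * z ^ k)
      = z / (1 - p * p ^ k) := by
    field_simp
    exact pow_succ z k
  rw [this, Real.norm_of_nonneg (by positivity)]
  rfl

/-- Euler's expansion of `1 / (z;p)_∞`. -/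
lemma tsum_pow_div_qPoch {p z : ℝ} (hp0 : 0 < p) (hp1 : p < 1) (hz0 : 0 < z) (hz1 : z < 1) :
    qPochInf z p * ∑' k, (qPoch p p k)⁻¹ * z ^ k = 1 := by
  have step : ∀ b : ℝ, 0 < b → b < 1 → ∑' k, (qPoch p p k)⁻¹ * (b * p) ^ k
      = (1 - b) * ∑' k, (qPoch p p k)⁻¹ * b ^ k := by
    intro b hb hb1
    have s1 := (summable_pow_div_qPoch hp0 hp1 hb hb1).of_norm
    have s2 := (summable_pow_div_qPoch hp0 hp1 (mul_pos hb hp0)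
      (mul_lt_one_of_nonneg_of_lt_one_left hb.le hb1 hp1.le)).of_norm
    have s1' := (summable_nat_add_iff 1).2 s1
    have key : ∑' k, (qPoch p p (k + 1))⁻¹ * (b * p) ^ (k + 1)
        = ∑' k, (qPoch p p (k + 1))⁻¹ * b ^ (k + 1)
          - b * ∑' k, (qPoch p p k)⁻¹ * b ^ k := by
      rw [← tsum_mul_left, ← s1'.tsum_sub (s1.mul_left b)]
      refine tsum_congr fun k => ?_
      have h1 := (qPoch_pos hp1 hp0.le hp0 hp1 k).ne'
      have h2 := (qPoch_pos hp1 hp0.le hp0 hp1 (k + 1)).ne'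
      rw [qPoch_succ] at h2 ⊢
      have h3 := right_ne_zero_of_mul h2
      field_simp
      ring
    rw [s2.tsum_eq_zero_add, key, one_sub_mul]
    conv_rhs => arg 1; rw [s1.tsum_eq_zero_add]
    simp only [pow_zero]
    ring
  have iter : ∀ N : ℕ, ∑' k, (qPoch p p k)⁻¹ * (z * p ^ N) ^ k
      = qPoch z p N * ∑' k, (qPoch p p k)⁻¹ * z ^ k := by
    intro N
    induction N with
    | zero => simp [qPoch]
    | succ N ih =>
      rw [pow_succ, ← mul_assoc, step _ (by positivity)
        (mul_lt_one_of_nonneg_of_lt_one_left hz0.le hz1 (pow_le_one₀ hp0.le hp1.le)), ih,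
        qPoch_succ]
      ring
  have h := (tendsto_qPoch z hp0 hp1).mul_const (∑' k, (qPoch p p k)⁻¹ * z ^ k)
  have h2 := tendsto_tsum_mul_pow hp0 hp1 (summable_pow_div_qPoch hp0 hp1 hz0 hz1)
  rw [tendsto_nhds_unique h (h2.congr iter)]
  simp [qPoch]

lemma qPochInf_ne_zero {p z : ℝ} (hp0 : 0 < p) (hp1 : p < 1) (hz0 : 0 < z) (hz1 : z < 1) :
    qPochInf z p ≠ 0 :=
  left_ne_zero_of_mul_eq_one (tsum_pow_div_qPoch hp0 hp1 hz0 hz1)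

/-- Symmetry of the `₁φ₁` series in its parameter and its argument. -/
lemma tsum_eulerCoeff_mul_qPochInf_comm {p a b : ℝ} (hp0 : 0 < p) (hp1 : p < 1)
    (ha : 0 < a) (hb : 0 < b) :
    ∑' j, eulerCoeff p j * a ^ j * qPochInf (b * p ^ j) p
      = ∑' k, eulerCoeff p k * b ^ k * qPochInf (a * p ^ k) p := by
  have hs : Summable (Function.uncurry fun j k : ℕ =>
      eulerCoeff p j * a ^ j * (eulerCoeff p k * b ^ k) * p ^ (j * k)) := by
    refine Summable.of_norm_bounded
      ((summable_eulerCoeff hp0 hp1 ha).mul_of_nonneg (summable_eulerCoeff hp0 hp1 hb)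
        (fun _ => norm_nonneg _) (fun _ => norm_nonneg _)) ?_
    rintro ⟨j, k⟩
    simp only [Function.uncurry_apply_pair]
    rw [norm_mul, norm_mul (eulerCoeff p j * a ^ j)]
    refine mul_le_of_le_one_right (by positivity) ?_
    rw [Real.norm_of_nonneg (by positivity)]
    exact pow_le_one₀ hp0.le hp1.le
  calc _ = ∑' j, ∑' k, eulerCoeff p j * a ^ j * (eulerCoeff p k * b ^ k) * p ^ (j * k) := by
        refine tsum_congr fun j => ?_
        rw [← tsum_eulerCoeff hp0 hp1 (by positivity), ← tsum_mul_left]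
        refine tsum_congr fun k => ?_
        rw [mul_pow, pow_mul]; ring
    _ = ∑' k, ∑' j, eulerCoeff p j * a ^ j * (eulerCoeff p k * b ^ k) * p ^ (j * k) :=
        hs.tsum_comm.symm
    _ = _ := by
        refine tsum_congr fun k => ?_
        rw [← tsum_eulerCoeff hp0 hp1 (by positivity), ← tsum_mul_left]
        refine tsum_congr fun j => ?_
        rw [mul_pow, mul_comm j k, pow_mul]; ring

lemma qPochInf_mul_jHE {q v : ℝ} (hq0 : 0 < q) (hq1 : q < 1) (hv : -1 < v) (n : ℤ) :
    qPochInf (q ^ (2 * v + 2)) (q ^ 2) * jHE q v (q ^ n)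
      = ∑' k, eulerCoeff (q ^ 2) k * (q ^ (2 * v + 2)) ^ k *
          qPochInf ((q ^ 2) ^ (1 + (n + k : ℤ))) (q ^ 2) := by
  have hp0 : 0 < q ^ 2 := by positivity
  have hp1 : q ^ 2 < 1 := pow_lt_one₀ hq0.le hq1 two_ne_zero
  have hw0 : 0 < q ^ (2 * v + 2) := Real.rpow_pos_of_pos hq0 _
  have hw1 : q ^ (2 * v + 2) < 1 := Real.rpow_lt_one hq0.le hq1 (by linarith)
  have hX : 0 < (q ^ 2) ^ (1 + n) := by positivity
  have h := tsum_eulerCoeff_mul_qPochInf_comm hp0 hp1 hX hw0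
  calc _ = _ := by
        rw [jHE, ← tsum_mul_left]
        refine tsum_congr fun j => ?_
        rw [← qPoch_mul_qPochInf (q ^ (2 * v + 2)) hp0 hp1 j, eulerCoeff]
        have h1 := (qPoch_pos hp1 hp0.le hp0 hp1 j).ne'
        have h2 := (qPoch_pos hw1 hw0.le hp0 hp1 j).ne'
        have h3 : q ^ (j * (j + 1)) * (q ^ n) ^ (2 * j)
            = (q ^ 2) ^ j.choose 2 * ((q ^ 2) ^ (1 + n)) ^ j := by
          have e : j * (j + 1) = 2 * j.choose 2 + 2 * j := by
            have h5 := Finset.sum_range_id_mul_two (j + 1)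
            have h6 := Finset.sum_range_succ (fun i => i) j
            rw [Nat.choose_two_right, ← Finset.sum_range_id]
            simp only [Nat.add_sub_cancel] at h5
            linarith
          rw [e, zpow_add₀ hp0.ne', zpow_one, mul_pow, pow_add, pow_mul, pow_mul, pow_mul,
            ← zpow_natCast q 2, ← zpow_natCast (q ^ n) 2, ← zpow_mul, ← zpow_mul, mul_comm n]
          ring
        generalize q ^ (2 * v + 2) = w at *
        rw [mul_assoc _ (q ^ _), h3]
        field_simp
    _ = _ := h
    _ = _ := by
        refine tsum_congr fun k => ?_
        rw [← add_assoc, zpow_add₀ hp0.ne' (1 + n) k, zpow_natCast]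

lemma qPochInf_zpow_eq_zero {p : ℝ} (hp0 : 0 < p) {i : ℤ} (hi : i < 0) :
    qPochInf (p ^ (1 + i)) p = 0 := by
  refine tprod_of_exists_eq_zero ⟨(-(1 + i)).toNat, ?_⟩
  rw [← zpow_natCast, ← zpow_add₀ hp0.ne', Int.toNat_of_nonneg (by omega)]
  simp

lemma hasSum_zpow_mul_qPochInf {p z : ℝ} (hp0 : 0 < p) (hp1 : p < 1) (hz0 : 0 < z) (hz1 : z < 1) :
    HasSum (fun i : ℤ => z ^ i * qPochInf (p ^ (1 + i)) p) (qPochInf p p / qPochInf z p) := by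
  refine (Function.Injective.hasSum_iff (Nat.cast_injective : Function.Injective
    (Nat.cast : ℕ → ℤ)) fun i hi => ?_).1 ?_
  · have hi' : i < 0 := by
      by_contra! h
      exact hi ⟨i.toNat, Int.toNat_of_nonneg h⟩
    rw [qPochInf_zpow_eq_zero hp0 hi', mul_zero]
  · have h := (summable_pow_div_qPoch hp0 hp1 hz0 hz1).of_norm.hasSum.mul_left (qPochInf p p)
    rw [eq_one_div_of_mul_eq_one_right (tsum_pow_div_qPoch hp0 hp1 hz0 hz1), mul_one_div] at h
    refine h.congr_fun fun m => ?_
    have h1 := (qPoch_pos hp1 hp0.le hp0 hp1 m).ne'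
    rw [Function.comp_apply, zpow_natCast, zpow_add₀ hp0.ne', zpow_one, zpow_natCast,
      ← qPoch_mul_qPochInf p hp0 hp1 m]
    field_simp

lemma hasSum_zpow_mul_jHE {q v z : ℝ} (hq0 : 0 < q) (hq1 : q < 1) (hv : -1 < v)
    (hz0 : 0 < z) (hz1 : z < 1) :
    HasSum (fun n : ℤ => z ^ n * (qPochInf (q ^ (2 * v + 2)) (q ^ 2) * jHE q v (q ^ n)))
      (qPochInf (q ^ (2 * v + 2) / z) (q ^ 2) *
        (qPochInf (q ^ 2) (q ^ 2) / qPochInf z (q ^ 2))) := by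
  have hp0 : 0 < q ^ 2 := by positivity
  have hp1 : q ^ 2 < 1 := pow_lt_one₀ hq0.le hq1 two_ne_zero
  have hw0 : 0 < q ^ (2 * v + 2) := Real.rpow_pos_of_pos hq0 _
  have hF := summable_eulerCoeff hp0 hp1 (div_pos hw0 hz0)
  have hG := hasSum_zpow_mul_qPochInf hp0 hp1 hz0 hz1
  have hFs := hF.of_norm.hasSum
  rw [tsum_eulerCoeff hp0 hp1 (div_pos hw0 hz0)] at hFs
  have hprod := hG.mul hFs (summable_mul_of_summable_norm hG.summable.norm hF)
  let shear : ℤ × ℕ ≃ ℤ × ℕ :=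
    { toFun := fun x => (x.1 + x.2, x.2)
      invFun := fun x => (x.1 - x.2, x.2)
      left_inv := fun x => by simp
      right_inv := fun x => by simp }
  have hsh := (shear.hasSum_iff).2 hprod
  have hfib : ∀ n : ℤ, Summable fun k : ℕ => _ := fun n => hsh.summable.prod_factor n
  have h := hsh.prod_fiberwise fun n => (hfib n).hasSum
  rw [mul_comm (_ / _)] at h
  refine h.congr_fun fun n => ?_
  rw [qPochInf_mul_jHE hq0 hq1 hv, ← tsum_mul_left]
  refine tsum_congr fun k => ?_
  simp only [shear, Function.comp, Equiv.coe_fn_mk]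
  rw [zpow_add₀ hz0.ne', zpow_natCast, div_pow]
  field_simp

/-- weighted bilateral summation formula for `j_v`. -/
theorem stmt15 (q v t : ℝ) (hq0 : 0 < q) (hq1 : q < 1) (hv : -1 < v)
    (hvt : -1 < v + t) (x : ℝ) (hx : x ∈ Rq q) :
    Summable (fun n : ℤ => |q ^ ((1 + v + t) * (n : ℝ)) * jHE q v (q ^ (n : ℤ) * x)|) ∧
    (1 - q) * cqv q v * ∑' n : ℤ, q ^ ((1 + v + t) * (n : ℝ)) * jHE q v (q ^ (n : ℤ) * x) =
      qPochInf (q ^ (1 + v - t)) (q ^ 2) / qPochInf (q ^ (1 + v + t)) (q ^ 2) *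
        x ^ (-(1 + v + t) : ℝ) := by
  obtain ⟨m, rfl⟩ := hx
  have hp0 : 0 < q ^ 2 := by positivity
  have hp1 : q ^ 2 < 1 := pow_lt_one₀ hq0.le hq1 two_ne_zero
  have hw0 : 0 < q ^ (2 * v + 2) := Real.rpow_pos_of_pos hq0 _
  have hw1 : q ^ (2 * v + 2) < 1 := Real.rpow_lt_one hq0.le hq1 (by linarith)
  have hz0 : 0 < q ^ (1 + v + t) := Real.rpow_pos_of_pos hq0 _
  have hz1 : q ^ (1 + v + t) < 1 := Real.rpow_lt_one hq0.le hq1 (by linarith)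
  have hwz : q ^ (2 * v + 2) / q ^ (1 + v + t) = q ^ (1 + v - t) := by
    rw [← Real.rpow_sub hq0]; congr 1; ring
  have hxm : ((q : ℝ) ^ m) ^ (-(1 + v + t) : ℝ) = (q ^ (1 + v + t)) ^ (-m) := by
    rw [← Real.rpow_intCast, ← Real.rpow_intCast, ← Real.rpow_mul hq0.le, ← Real.rpow_mul hq0.le]
    congr 1; push_cast; ring
  have hW := qPochInf_ne_zero hp0 hp1 hw0 hw1
  have hP := qPochInf_ne_zero hp0 hp1 hp0 hp1
  have hZ := qPochInf_ne_zero hp0 hp1 hz0 hz1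
  have h0 := hasSum_zpow_mul_jHE hq0 hq1 hv hz0 hz1
  rw [hwz] at h0
  have h1 := ((Equiv.addRight m).hasSum_iff.2 h0).mul_left
    ((q ^ (1 + v + t)) ^ (-m) / qPochInf (q ^ (2 * v + 2)) (q ^ 2))
  have hterm : ∀ n : ℤ, q ^ ((1 + v + t) * (n : ℝ)) * jHE q v (q ^ n * q ^ m)
      = (q ^ (1 + v + t)) ^ (-m) / qPochInf (q ^ (2 * v + 2)) (q ^ 2) *
        ((q ^ (1 + v + t)) ^ (n + m) *
          (qPochInf (q ^ (2 * v + 2)) (q ^ 2) * jHE q v (q ^ (n + m)))) := by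
    intro n
    rw [Real.rpow_mul hq0.le, Real.rpow_intCast, zpow_add₀ hz0.ne', zpow_add₀ hq0.ne', zpow_neg]
    generalize qPochInf (q ^ (2 * v + 2)) (q ^ 2) = W at *
    field_simp
  have h2 := h1.congr_fun hterm
  refine ⟨h2.summable.abs, ?_⟩
  rw [h2.tsum_eq, hxm, cqv]
  have : 1 - q ≠ 0 := by linarith
  generalize qPochInf (q ^ (2 * v + 2)) (q ^ 2) = W at *
  field_simp
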